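/- Let 1 < q < ∞ and q* = q/(q−1). Then for all x ∈ [0, π_{q/2,q}/2) (equivalently x ∈ [0, π_{2q/(q+2),q}/2^{2/q+1})), sinh_{2,q}(2^{2/q} x) = 2^{2/q} · sinh_{q*,q}(x) · (cosh_{q*,q}(x))^{q*−1}. -/

import Mathlib

open MeasureTheory Set
open scoped ENNReal

/-- `genF p q y = ∫_0^y (1 - t^q)^(-1/p) dt`, whose inverse is the generalized sine. -/
noncomputable def genF (p q y : ℝ) : ℝ := ∫ t in (0:ℝ)..y, (1 - t ^ q) ^ (-(1 / p))

/-- `genG p q y = ∫_0^y (1 + t^q)^(-1/p) dt`, whose inverse is the generalized hyperbolic sine. -/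
noncomputable def genG (p q y : ℝ) : ℝ := ∫ t in (0:ℝ)..y, (1 + t ^ q) ^ (-(1 / p))

/-- The generalized π, `π_{p,q} = 2∫_0^1 (1 - t^q)^(-1/p) dt`, as an extended real number
(it is `∞` when `q/(q+1) < p ≤ 1`). -/
noncomputable def genPi (p q : ℝ) : ℝ≥0∞ :=
  2 * ∫⁻ t in Ioo (0:ℝ) 1, ENNReal.ofReal ((1 - t ^ q) ^ (-(1 / p)))

/-- The generalized sine `sin_{p,q}`: the inverse of `genF p q`, which maps `[0,1)` onto
`[0, π_{p,q}/2)`. -/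
noncomputable def gsin (p q : ℝ) : ℝ → ℝ := Function.invFunOn (genF p q) (Ico 0 1)

/-- The generalized cosine `cos_{p,q} x = (d/dx) sin_{p,q} x` (one-sided at `x = 0`). -/
noncomputable def gcos (p q x : ℝ) : ℝ := derivWithin (gsin p q) (Ici 0) x

/-- The generalized hyperbolic sine `sinh_{p,q}`: the inverse of `genG p q`, which maps
`[0,∞)` onto `[0, π_{r,q}/2)` where `r = pq/(pq+p-q)`. -/
noncomputable def gsinh (p q : ℝ) : ℝ → ℝ := Function.invFunOn (genG p q) (Ici 0)

/-- The generalized hyperbolic cosine `cosh_{p,q} x = (d/dx) sinh_{p,q} x`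
(one-sided at `x = 0`). -/
noncomputable def gcosh (p q x : ℝ) : ℝ := derivWithin (gsinh p q) (Ici 0) x

section GenG

variable {p q : ℝ}

lemma measurable_genG_integrand (p q : ℝ) :
    Measurable fun t : ℝ => (1 + t ^ q) ^ (-(1 / p)) := by fun_prop

lemma continuousAt_genG_integrand (hq : 0 < q) {t : ℝ} (ht : 0 ≤ t) :
    ContinuousAt (fun t : ℝ => (1 + t ^ q) ^ (-(1 / p))) t := by
  have h : (0:ℝ) ≤ t ^ q := Real.rpow_nonneg ht q
  refine ContinuousAt.rpow_const ?_ (Or.inl (by positivity))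
  exact continuousAt_const.add (Real.continuousAt_rpow_const t q (Or.inr hq.le))

lemma intervalIntegrable_genG_integrand (hq : 0 < q) {a b : ℝ} (ha : 0 ≤ a) (hb : 0 ≤ b) :
    IntervalIntegrable (fun t : ℝ => (1 + t ^ q) ^ (-(1 / p))) volume a b :=
  ContinuousOn.intervalIntegrable fun _ ht =>
    (continuousAt_genG_integrand hq ((le_min ha hb).trans ht.1)).continuousWithinAt

lemma hasStrictDerivAt_genG (hq : 0 < q) {y : ℝ} (hy : 0 ≤ y) :
    HasStrictDerivAt (genG p q) ((1 + y ^ q) ^ (-(1 / p))) y :=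
  intervalIntegral.integral_hasStrictDerivAt_right
    (intervalIntegrable_genG_integrand hq le_rfl hy)
    (measurable_genG_integrand p q).stronglyMeasurable.stronglyMeasurableAtFilter
    (continuousAt_genG_integrand hq hy)

@[simp] lemma genG_zero (p q : ℝ) : genG p q 0 = 0 := intervalIntegral.integral_same

lemma continuousOn_genG (hq : 0 < q) : ContinuousOn (genG p q) (Ici 0) := fun _ hy =>
  (hasStrictDerivAt_genG hq hy).hasDerivAt.continuousAt.continuousWithinAt

lemma strictMonoOn_genG (hq : 0 < q) : StrictMonoOn (genG p q) (Ici 0) := by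
  refine strictMonoOn_of_deriv_pos (convex_Ici 0) (continuousOn_genG hq) fun y hy => ?_
  rw [interior_Ici] at hy
  have hy : (0:ℝ) < y := hy
  rw [(hasStrictDerivAt_genG hq hy.le).hasDerivAt.deriv]
  positivity

lemma gsinh_genG (hq : 0 < q) {y : ℝ} (hy : 0 ≤ y) : gsinh p q (genG p q y) = y :=
  (strictMonoOn_genG hq).injOn.leftInvOn_invFunOn hy

lemma gcosh_genG (hq : 0 < q) {y : ℝ} (hy : 0 < y) :
    gcosh p q (genG p q y) = (1 + y ^ q) ^ (1 / p) := by
  have hpos : 0 < genG p q y := by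
    simpa using strictMonoOn_genG (p := p) hq self_mem_Ici hy.le hy
  have hne : (1 + y ^ q) ^ (-(1 / p)) ≠ 0 := by positivity
  have h := (hasStrictDerivAt_genG (p := p) hq hy.le).to_local_left_inverse (g := gsinh p q) hne
    (by filter_upwards [Ioi_mem_nhds hy] with z hz using gsinh_genG hq (le_of_lt hz))
  rw [gcosh, derivWithin_of_mem_nhds (Ici_mem_nhds hpos), h.hasDerivAt.deriv,
    Real.rpow_neg (by positivity), inv_inv]

end GenG

lemma genG_two_multiple_angle {q : ℝ} (hq : 1 < q) {s : ℝ} (hs : 0 ≤ s) :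
    genG 2 q ((2:ℝ) ^ (2 / q) * s * (1 + s ^ q) ^ (1 / q)) =
      (2:ℝ) ^ (2 / q) * genG (q / (q - 1)) q s := by
  have hq0 : 0 < q := by linarith
  have hderiv : ∀ t ∈ uIcc 0 s,
      HasDerivAt (fun t => genG 2 q ((2:ℝ) ^ (2 / q) * t * (1 + t ^ q) ^ (1 / q)))
        ((2:ℝ) ^ (2 / q) * (1 + t ^ q) ^ (-(1 / (q / (q - 1))))) t := by
    intro t ht
    rw [uIcc_of_le hs] at ht
    have ht0 : 0 ≤ t := ht.1
    have hA : 0 ≤ t ^ q := Real.rpow_nonneg ht0 q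
    have hB : 0 < 1 + t ^ q := by positivity
    have hinner := ((hasDerivAt_id t).const_mul ((2:ℝ) ^ (2 / q))).mul
      (((Real.hasDerivAt_rpow_const (x := t) (p := q) (Or.inr hq.le)).const_add 1).rpow_const
        (p := 1 / q) (Or.inl hB.ne'))
    have houter := (hasStrictDerivAt_genG (p := 2) hq0
      (y := (2:ℝ) ^ (2 / q) * t * (1 + t ^ q) ^ (1 / q)) (by positivity)).hasDerivAt
    refine (houter.comp t hinner).congr_deriv ?_
    have hpow : ((2:ℝ) ^ (2 / q) * t * (1 + t ^ q) ^ (1 / q)) ^ q = 4 * t ^ q * (1 + t ^ q) := by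
      rw [Real.mul_rpow (by positivity) (by positivity), Real.mul_rpow (by positivity) ht0,
        ← Real.rpow_mul (by norm_num), ← Real.rpow_mul hB.le, div_mul_cancel₀ _ hq0.ne',
        div_mul_cancel₀ _ hq0.ne']
      norm_num
    have hroot : (1 + 4 * t ^ q * (1 + t ^ q)) ^ (-(1 / 2) : ℝ) = (1 + 2 * t ^ q)⁻¹ := by
      rw [show 1 + 4 * t ^ q * (1 + t ^ q) = (1 + 2 * t ^ q) ^ (2:ℝ) by
        rw [Real.rpow_two]; ring, ← Real.rpow_mul (by positivity)]
      norm_num [Real.rpow_neg_one]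
    have hexp : -(1 / (q / (q - 1))) = 1 / q - 1 := by
      field_simp; ring
    have hmul : t * t ^ (q - 1) = t ^ q := by
      rcases ht0.eq_or_lt with rfl | h
      · rw [zero_mul, Real.zero_rpow hq0.ne']
      · rw [Real.rpow_sub_one h.ne']; field_simp
    have hsplit : (1 + t ^ q) ^ (1 / q) = (1 + t ^ q) ^ (1 / q - 1) * (1 + t ^ q) := by
      rw [Real.rpow_sub_one hB.ne']; field_simp
    simp only [id]
    rw [hpow, hroot, hexp]
    generalize hE : (1 + t ^ q) ^ (1 / q - 1) = E at *
    rw [hsplit]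
    have h2 : 1 + 2 * t ^ q ≠ 0 := by positivity
    field_simp
    linear_combination E * hmul
  have hint := intervalIntegral.integral_eq_sub_of_hasDerivAt hderiv
    ((intervalIntegrable_genG_integrand hq0 le_rfl hs).const_mul _)
  rw [intervalIntegral.integral_const_mul] at hint
  simpa [genG] using hint.symm

lemma continuousOn_genF_integrand {p q u : ℝ} (hq : 0 < q) (hu1 : u < 1) :
    ContinuousOn (fun t : ℝ => (1 - t ^ q) ^ (-(1 / p))) (Icc 0 u) := by
  intro t ht
  have : t ^ q < 1 := Real.rpow_lt_one ht.1 (ht.2.trans_lt hu1) hq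
  refine (ContinuousAt.rpow_const ?_ (Or.inl (by linarith))).continuousWithinAt
  exact continuousAt_const.sub (Real.continuousAt_rpow_const t q (Or.inr hq.le))

lemma genF_eq_genG {q u : ℝ} (hq : 1 < q) (hu0 : 0 ≤ u) (hu1 : u < 1) :
    genF (q / 2) q u = genG (q / (q - 1)) q (u * (1 - u ^ q) ^ (-(1 / q))) := by
  have hq0 : 0 < q := by linarith
  have hderiv : ∀ t ∈ uIcc 0 u,
      HasDerivAt (fun t => genG (q / (q - 1)) q (t * (1 - t ^ q) ^ (-(1 / q))))
        ((1 - t ^ q) ^ (-(1 / (q / 2)))) t := by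
    intro t ht
    rw [uIcc_of_le hu0] at ht
    have ht0 : 0 ≤ t := ht.1
    have hB : 0 < 1 - t ^ q := by
      linarith [Real.rpow_lt_one ht.1 (ht.2.trans_lt hu1) hq0]
    have hinner := (hasDerivAt_id t).mul
      (((Real.hasDerivAt_rpow_const (x := t) (p := q) (Or.inr hq.le)).const_sub 1).rpow_const
        (p := -(1 / q)) (Or.inl hB.ne'))
    have houter := (hasStrictDerivAt_genG (p := q / (q - 1)) hq0
      (y := t * (1 - t ^ q) ^ (-(1 / q))) (by positivity)).hasDerivAt
    refine (houter.comp t hinner).congr_deriv ?_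
    have hpow : 1 + (t * (1 - t ^ q) ^ (-(1 / q))) ^ q = (1 - t ^ q)⁻¹ := by
      rw [Real.mul_rpow ht0 (by positivity), ← Real.rpow_mul hB.le,
        show -(1 / q) * q = -1 by field_simp, Real.rpow_neg_one]
      field_simp; ring
    have hmul : t * t ^ (q - 1) = t ^ q := by
      rcases ht0.eq_or_lt with rfl | h
      · rw [zero_mul, Real.zero_rpow hq0.ne']
      · rw [Real.rpow_sub_one h.ne']; field_simp
    have hsplit : (1 - t ^ q) ^ (-(1 / q)) = (1 - t ^ q) ^ (-(1 / q) - 1) * (1 - t ^ q) := by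
      rw [Real.rpow_sub_one hB.ne']; field_simp
    have hprod : (1 - t ^ q) ^ (-(1 / (q / 2))) =
        (1 - t ^ q) ^ (1 / (q / (q - 1))) * (1 - t ^ q) ^ (-(1 / q) - 1) := by
      rw [← Real.rpow_add hB]
      congr 1
      field_simp; ring
    simp only [id]
    rw [hpow, Real.inv_rpow hB.le, Real.rpow_neg hB.le, inv_inv, hprod]
    generalize hE : (1 - t ^ q) ^ (-(1 / q) - 1) = E at *
    rw [hsplit]
    field_simp
    linear_combination E * hmul
  have hint := intervalIntegral.integral_eq_sub_of_hasDerivAt hderiv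
    ((continuousOn_genF_integrand hq0 hu1).intervalIntegrable_of_Icc hu0)
  simpa [genF] using hint

lemma exists_lt_genF {p q x : ℝ} (hq : 0 < q) (hx : ENNReal.ofReal x < genPi p q / 2) :
    ∃ u, 0 ≤ u ∧ u < 1 ∧ x < genF p q u := by
  rw [genPi, mul_comm, ENNReal.mul_div_cancel_right (by simp) (by simp)] at hx
  obtain ⟨v, hvmono, hv, hvlim⟩ := exists_seq_strictMono_tendsto' (zero_lt_one (α := ℝ))
  have hunion : Ioo (0:ℝ) 1 = ⋃ n, Ioo 0 (v n) := by
    ext t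
    simp only [mem_Ioo, mem_iUnion]
    constructor
    · rintro ⟨h0, h1⟩
      obtain ⟨n, hn⟩ := (hvlim.eventually_const_lt h1).exists
      exact ⟨n, h0, hn⟩
    · rintro ⟨n, h0, h1⟩
      exact ⟨h0, h1.trans (hv n).2⟩
  rw [hunion, setLIntegral_iUnion_of_directed _
    (Monotone.directed_le fun _ _ h => Ioo_subset_Ioo_right (hvmono.monotone h)),
    lt_iSup_iff] at hx
  obtain ⟨n, hn⟩ := hx
  have h0 := (hv n).1
  have h1 := (hv n).2
  refine ⟨v n, h0.le, h1, ?_⟩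
  have hint := ((continuousOn_genF_integrand (p := p) hq h1).integrableOn_Icc
    (μ := volume)).mono_set
    Ioo_subset_Icc_self
  rw [← ofReal_integral_eq_lintegral_ofReal hint, ← integral_Ioc_eq_integral_Ioo,
    ← intervalIntegral.integral_of_le h0.le] at hn
  · exact (ENNReal.ofReal_lt_ofReal_iff'.1 hn).1
  · filter_upwards [ae_restrict_mem measurableSet_Ioo] with t ht
    have := Real.rpow_lt_one ht.1.le (ht.2.trans h1) hq
    exact Real.rpow_nonneg (by linarith) _

lemma exists_genG_eq {q x : ℝ} (hq : 1 < q) (hx0 : 0 ≤ x)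
    (hx : ENNReal.ofReal x < genPi (q / 2) q / 2) :
    ∃ s, 0 ≤ s ∧ genG (q / (q - 1)) q s = x := by
  have hq0 : 0 < q := by linarith
  obtain ⟨u, hu0, hu1, hu⟩ := exists_lt_genF hq0 hx
  rw [genF_eq_genG hq hu0 hu1] at hu
  have hB : 0 < 1 - u ^ q := by linarith [Real.rpow_lt_one hu0 hu1 hq0]
  have hy : 0 ≤ u * (1 - u ^ q) ^ (-(1 / q)) := by positivity
  obtain ⟨s, hs, hsx⟩ := intermediate_value_Icc hy
    ((continuousOn_genG (p := q / (q - 1)) hq0).mono Icc_subset_Ici_self)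
    (show x ∈ Icc _ _ from ⟨by simpa using hx0, hu.le⟩)
  exact ⟨s, hs.1, hsx⟩

/-- for `1 < q < ∞`, `q* = q/(q-1)` and `x ∈ [0, π_{q/2,q}/2)`,
`sinh_{2,q}(2^(2/q) x) = 2^(2/q) · sinh_{q*,q} x · (cosh_{q*,q} x)^(q*-1)`. -/
theorem multiple_angle_sinh2 (q qs : ℝ) (hq : 1 < q) (hqs : qs = q / (q - 1))
    (x : ℝ) (hx0 : 0 ≤ x) (hx : ENNReal.ofReal x < genPi (q / 2) q / 2) :
    gsinh 2 q ((2:ℝ) ^ (2 / q) * x) =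
      (2:ℝ) ^ (2 / q) * gsinh qs q x * gcosh qs q x ^ (qs - 1) := by
  have hq0 : 0 < q := by linarith
  have hq1 : 0 < q - 1 := by linarith
  obtain ⟨s, hs0, rfl⟩ := exists_genG_eq hq hx0 hx
  rw [← genG_two_multiple_angle hq hs0, gsinh_genG hq0 (by positivity), hqs, gsinh_genG hq0 hs0]
  rcases hs0.eq_or_lt with rfl | hs
  · simp
  · rw [gcosh_genG hq0 hs, ← Real.rpow_mul (by positivity)]
    congr 2
    field_simp
    ring
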